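/- For every T > 0, M ≥ 1 and ε ∈ (0,1] there exists a constant C > 0, depending only on M, ε and T, such that every smooth solution (v,u,θ,q) of the radiation hydrodynamics system on [0,T] with (M,ε)-bounded initial data satisfies ∫_𝕋 q_x(t,x)²/v(t,x) dx + ∫_𝕋 v(t,x) q(t,x)² dx ≤ C(1 + 𝔜(t)^{8/(2β+3)}) for all t ∈ [0,T]. -/

import Mathlib

open MeasureTheory Real Set

noncomputable section

namespace RadHydro

/-- Integral over one period `[-1/2, 1/2]` of the torus `𝕋 ≅ ℝ/ℤ`. -/
def tInt (f : ℝ → ℝ) : ℝ := ∫ x in (-(1/2) : ℝ)..(1/2 : ℝ), f x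

/-- Squared `L²` norm over the torus. -/
def L2sq (f : ℝ → ℝ) : ℝ := tInt fun x => (f x) ^ 2

/-- `L^∞` norm over the torus. -/
def Linf (f : ℝ → ℝ) : ℝ := sSup ((fun x => |f x|) '' Icc (-(1/2) : ℝ) (1/2))

/-- Squared `H¹` norm over the torus. -/
def H1sq (f : ℝ → ℝ) : ℝ := L2sq f + L2sq (deriv f)

/-- Squared `H²` norm over the torus. -/
def H2sq (f : ℝ → ℝ) : ℝ := L2sq f + L2sq (deriv f) + L2sq (deriv (deriv f))

/-- Partial derivative in the time variable. -/
def pt (f : ℝ → ℝ → ℝ) (t x : ℝ) : ℝ := deriv (fun s => f s x) t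

/-- Partial derivative in the space variable. -/
def px (f : ℝ → ℝ → ℝ) (t x : ℝ) : ℝ := deriv (f t) x

/-- The heat conductivity `κ(v, θ) = κ₁ + κ₂ v θ^β`. -/
def kappa (κ₁ κ₂ β v θ : ℝ) : ℝ := κ₁ + κ₂ * v * θ ^ β

/-- A smooth solution of the radiation hydrodynamics system (in Lagrangian
coordinates) on `[0, T]`: four `C^∞` functions on `[0,T] × ℝ` (modelled as smooth
functions on all of `ℝ × ℝ`), `1`-periodic in the space variable, with `v > 0`,
`θ > 0`, satisfying the four equations pointwise for `t ∈ [0, T]`, and with the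
normalization `∫_𝕋 v(0, x) dx = 1`. -/
structure Sol (μ R a b κ₁ κ₂ β γ T : ℝ) where
  v : ℝ → ℝ → ℝ
  u : ℝ → ℝ → ℝ
  θ : ℝ → ℝ → ℝ
  q : ℝ → ℝ → ℝ
  smooth_v : ContDiff ℝ (⊤ : ℕ∞) fun p : ℝ × ℝ => v p.1 p.2
  smooth_u : ContDiff ℝ (⊤ : ℕ∞) fun p : ℝ × ℝ => u p.1 p.2
  smooth_θ : ContDiff ℝ (⊤ : ℕ∞) fun p : ℝ × ℝ => θ p.1 p.2
  smooth_q : ContDiff ℝ (⊤ : ℕ∞) fun p : ℝ × ℝ => q p.1 p.2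
  periodic_v : ∀ t, Function.Periodic (v t) 1
  periodic_u : ∀ t, Function.Periodic (u t) 1
  periodic_θ : ∀ t, Function.Periodic (θ t) 1
  periodic_q : ∀ t, Function.Periodic (q t) 1
  v_pos : ∀ t x, 0 < v t x
  θ_pos : ∀ t x, 0 < θ t x
  eq_mass : ∀ t ∈ Icc (0 : ℝ) T, ∀ x : ℝ, pt v t x - px u t x = 0
  eq_mom : ∀ t ∈ Icc (0 : ℝ) T, ∀ x : ℝ,
    pt u t x + px (fun s y => R * θ s y / v s y) t x
      = px (fun s y => μ * px u s y / v s y) t x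
  eq_energy : ∀ t ∈ Icc (0 : ℝ) T, ∀ x : ℝ,
    pt (fun s y => R / (γ - 1) * θ s y + (u s y) ^ 2 / 2) t x
      + px (fun s y => R * θ s y / v s y * u s y) t x + px q t x
      = px (fun s y => μ * u s y * px u s y / v s y) t x
        + px (fun s y => kappa κ₁ κ₂ β (v s y) (θ s y) * px θ s y / v s y) t x
  eq_rad : ∀ t ∈ Icc (0 : ℝ) T, ∀ x : ℝ,
    -px (fun s y => px q s y / v s y) t x + a * v t x * q t x
      + b * px (fun s y => (θ s y) ^ 4) t x = 0
  mean_v : tInt (v 0) = 1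

/-- `(M, ε)`-bounded initial data: `‖(v₀, u₀, θ₀)‖_{H²} ≤ M` and `v₀ ≥ ε`, `θ₀ ≥ ε`. -/
def DataBounded (M ε : ℝ) (v₀ u₀ θ₀ : ℝ → ℝ) : Prop :=
  Real.sqrt (H2sq v₀ + H2sq u₀ + H2sq θ₀) ≤ M ∧ (∀ x, ε ≤ v₀ x) ∧ ∀ x, ε ≤ θ₀ x

variable {μ R a b κ₁ κ₂ β γ T : ℝ}

/-- A solution has `(M, ε)`-bounded initial data. -/
def Sol.Bounded (S : Sol μ R a b κ₁ κ₂ β γ T) (M ε : ℝ) : Prop :=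
  DataBounded M ε (S.v 0) (S.u 0) (S.θ 0)

/-- The auxiliary function `𝔛(t) = ∫₀ᵗ ∫_𝕋 κ(v,θ) θ_t² / v dx ds`. -/
def Sol.X (S : Sol μ R a b κ₁ κ₂ β γ T) (t : ℝ) : ℝ :=
  ∫ s in (0 : ℝ)..t, tInt fun x =>
    kappa κ₁ κ₂ β (S.v s x) (S.θ s x) * (pt S.θ s x) ^ 2 / S.v s x

/-- The auxiliary function `𝔜(t) = max_{0 ≤ s ≤ t} ∫_𝕋 κ(v,θ)² θ_x² / v² dx`. -/
def Sol.Y (S : Sol μ R a b κ₁ κ₂ β γ T) (t : ℝ) : ℝ :=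
  sSup ((fun s => tInt fun x =>
    (kappa κ₁ κ₂ β (S.v s x) (S.θ s x)) ^ 2 * (px S.θ s x) ^ 2 / (S.v s x) ^ 2) ''
      Icc (0 : ℝ) t)

/-- The auxiliary function `ℨ(t) = max_{0 ≤ s ≤ t} ∫_𝕋 u_{xx}² / v² dx`. -/
def Sol.Z (S : Sol μ R a b κ₁ κ₂ β γ T) (t : ℝ) : ℝ :=
  sSup ((fun s => tInt fun x => (px (px S.u) s x) ^ 2 / (S.v s x) ^ 2) '' Icc (0 : ℝ) t)

/-- The exponent `𝔗₀(n, p, β)`. -/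
def T0 (n _p β : ℝ) : ℝ :=
  if n < (β + 3) / 2 then 4 / (n * (2 * β + 3)) else (n - β + 5) / (n * (2 * β + 3))

/-- The exponent `𝔗₁(n, β)`. -/
def T1 (n β : ℝ) : ℝ := max (T0 n 8 β) (1 / (2 * β + 3) + T0 n 1 β)

/-- The exponent `𝔘ʸ₁₁(n, β)`. -/
def Uy11 (n β : ℝ) : ℝ := 2 / (2 * β + 3) + T0 n 1 β

/-- The exponent `𝔘ᶻ₁₁(n, β)`. -/
def Uz11 (n β : ℝ) : ℝ := 3 / 4 * (1 / (1 - T0 n (5/2) β))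

/-- The exponent `𝔘ʸ₂(n, β)`. -/
def Uy2 (n β : ℝ) : ℝ := 2 / (2 * β + 3) + T1 n β

/-- The exponent `𝔘ᶻ₂(n, β)`. -/
def Uz2 (n β : ℝ) : ℝ := 3 / 4 * (1 / (1 - T0 n (3/2) β - T1 n β))

end RadHydro

open RadHydro

namespace RadHydro

section Calculus

lemma contDiff_px {f : ℝ → ℝ → ℝ} (hf : ContDiff ℝ (⊤ : ℕ∞) fun p : ℝ × ℝ => f p.1 p.2) :
    ContDiff ℝ (⊤ : ℕ∞) fun p : ℝ × ℝ => px f p.1 p.2 := by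
  have h1 : ContDiff ℝ (⊤ : ℕ∞)
      fun p : ℝ × ℝ => fderiv ℝ (fun p : ℝ × ℝ => f p.1 p.2) p (0, 1) :=
    (hf.fderiv_right (m := (⊤ : ℕ∞)) (by norm_cast)).clm_apply contDiff_const
  convert h1 using 2 with p
  have h2 : HasFDerivAt (fun p : ℝ × ℝ => f p.1 p.2) _ (p.1, p.2) :=
    (hf.differentiable (by simp) (p.1, p.2)).hasFDerivAt
  exact (h2.comp_hasDerivAt p.2
    ((hasDerivAt_const p.2 p.1).prodMk (hasDerivAt_id p.2))).deriv

lemma contDiff_pt {f : ℝ → ℝ → ℝ} (hf : ContDiff ℝ (⊤ : ℕ∞) fun p : ℝ × ℝ => f p.1 p.2) :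
    ContDiff ℝ (⊤ : ℕ∞) fun p : ℝ × ℝ => pt f p.1 p.2 := by
  have h1 : ContDiff ℝ (⊤ : ℕ∞)
      fun p : ℝ × ℝ => fderiv ℝ (fun p : ℝ × ℝ => f p.1 p.2) p (1, 0) :=
    (hf.fderiv_right (m := (⊤ : ℕ∞)) (by norm_cast)).clm_apply contDiff_const
  convert h1 using 2 with p
  have h2 : HasFDerivAt (fun p : ℝ × ℝ => f p.1 p.2) _ (p.1, p.2) :=
    (hf.differentiable (by simp) (p.1, p.2)).hasFDerivAt
  exact (h2.comp_hasDerivAt p.1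
    ((hasDerivAt_id p.1).prodMk (hasDerivAt_const p.1 p.2))).deriv

lemma contDiff_slice {f : ℝ → ℝ → ℝ} (hf : ContDiff ℝ (⊤ : ℕ∞) fun p : ℝ × ℝ => f p.1 p.2)
    (t : ℝ) : ContDiff ℝ (⊤ : ℕ∞) (f t) :=
  hf.comp (contDiff_const.prodMk contDiff_id : ContDiff ℝ (⊤ : ℕ∞) fun x : ℝ => (t, x))

lemma hasDerivAt_px {f : ℝ → ℝ → ℝ} (hf : ContDiff ℝ (⊤ : ℕ∞) fun p : ℝ × ℝ => f p.1 p.2)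
    (t x : ℝ) : HasDerivAt (f t) (px f t x) x :=
  ((contDiff_slice hf t).differentiable (by simp) x).hasDerivAt

lemma hasDerivAt_pt {f : ℝ → ℝ → ℝ} (hf : ContDiff ℝ (⊤ : ℕ∞) fun p : ℝ × ℝ => f p.1 p.2)
    (t x : ℝ) : HasDerivAt (fun s => f s x) (pt f t x) t :=
  ((hf.comp (contDiff_id.prodMk contDiff_const :
    ContDiff ℝ (⊤ : ℕ∞) fun s : ℝ => (s, x))).differentiable (by simp) t).hasDerivAt

lemma periodic_px {f : ℝ → ℝ → ℝ} (hf : ∀ t, Function.Periodic (f t) 1) (t : ℝ) :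
    Function.Periodic (px f t) 1 := by
  intro x
  have h : (fun y => f t (y + 1)) = f t := funext (hf t)
  unfold px
  rw [← deriv_comp_add_const, h]

lemma tInt_eq_zero_of_periodic {g g' : ℝ → ℝ} (hg : Function.Periodic g 1)
    (hd : ∀ x, HasDerivAt g (g' x) x) (hc : Continuous g') : tInt g' = 0 := by
  unfold tInt
  rw [intervalIntegral.integral_eq_sub_of_hasDerivAt (fun x _ => hd x)
    (hc.intervalIntegrable _ _), sub_eq_zero]
  rw [← hg (-(1 / 2))]
  norm_num

lemma tInt_mono {f g : ℝ → ℝ} (hf : Continuous f) (hg : Continuous g) (h : ∀ x, f x ≤ g x) :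
    tInt f ≤ tInt g :=
  intervalIntegral.integral_mono_on (by norm_num) (hf.intervalIntegrable _ _)
    (hg.intervalIntegrable _ _) fun x _ => h x

lemma tInt_nonneg {f : ℝ → ℝ} (h : ∀ x, 0 ≤ f x) : 0 ≤ tInt f :=
  intervalIntegral.integral_nonneg (by norm_num) fun x _ => h x

lemma tInt_add {f g : ℝ → ℝ} (hf : Continuous f) (hg : Continuous g) :
    tInt (fun x => f x + g x) = tInt f + tInt g :=
  intervalIntegral.integral_add (hf.intervalIntegrable _ _) (hg.intervalIntegrable _ _)

lemma tInt_const_mul (c : ℝ) (f : ℝ → ℝ) : tInt (fun x => c * f x) = c * tInt f :=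
  intervalIntegral.integral_const_mul _ _

lemma tInt_const (c : ℝ) : tInt (fun _ => c) = c := by
  simp [tInt]; norm_num

/-- A density whose time derivative is the space derivative of a periodic flux has a
conserved integral. -/
lemma tInt_conserved {f g : ℝ → ℝ → ℝ} {T t : ℝ}
    (hf : ContDiff ℝ (⊤ : ℕ∞) fun p : ℝ × ℝ => f p.1 p.2)
    (hg : ContDiff ℝ (⊤ : ℕ∞) fun p : ℝ × ℝ => g p.1 p.2)
    (hper : ∀ t, Function.Periodic (g t) 1)
    (heq : ∀ s ∈ Icc (0 : ℝ) T, ∀ x, pt f s x = px g s x) (ht : t ∈ Icc (0 : ℝ) T) :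
    tInt (f t) = tInt (f 0) := by
  have hft := (contDiff_pt hf).continuous
  have h1 : ∀ x, ∫ s in (0 : ℝ)..t, pt f s x = f t x - f 0 x := fun x =>
    intervalIntegral.integral_eq_sub_of_hasDerivAt (fun s _ => hasDerivAt_pt hf s x)
      ((hft.comp (by fun_prop : Continuous fun s : ℝ => (s, x))).intervalIntegrable _ _)
  have h2 : ∀ s ∈ Icc (0 : ℝ) T, tInt (fun x => pt f s x) = 0 := fun s hs =>
    tInt_eq_zero_of_periodic (hper s) (fun x => heq s hs x ▸ hasDerivAt_px hg s x)
      (hft.comp (by fun_prop : Continuous fun x : ℝ => (s, x)))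
  have h3 : tInt (fun x => f t x - f 0 x) = 0 := by
    unfold tInt
    simp_rw [← h1]
    rw [intervalIntegral_intervalIntegral_swap]
    · refine (intervalIntegral.integral_congr (g := fun _ => (0 : ℝ)) fun s hs => ?_).trans
        (by simp)
      rw [uIcc_of_le ht.1] at hs
      exact h2 s ⟨hs.1, hs.2.trans ht.2⟩
    · have hc : Continuous (Function.uncurry fun x s : ℝ => pt f s x) :=
        hft.comp (by fun_prop : Continuous fun p : ℝ × ℝ => (p.2, p.1))
      exact (hc.continuousOn.integrableOn_compact
        (isCompact_uIcc.prod isCompact_uIcc)).mono_set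
        (Set.prod_mono uIoc_subset_uIcc uIoc_subset_uIcc)
  unfold tInt at h3 ⊢
  rw [intervalIntegral.integral_sub ((contDiff_slice hf t).continuous.intervalIntegrable _ _)
    ((contDiff_slice hf 0).continuous.intervalIntegrable _ _)] at h3
  linarith

lemma continuous_tInt {f : ℝ → ℝ → ℝ} (hf : Continuous fun p : ℝ × ℝ => f p.1 p.2) :
    Continuous fun t => tInt (f t) :=
  intervalIntegral.continuous_parametric_intervalIntegral_of_continuous' hf _ _

lemma sub_le_tInt_of_abs_deriv_le {g g' h : ℝ → ℝ} (hd : ∀ x, HasDerivAt g (g' x) x)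
    (hc : Continuous g') (hh : Continuous h) (hle : ∀ x, |g' x| ≤ h x) {x y : ℝ}
    (hx : x ∈ Icc (-(1 / 2) : ℝ) (1 / 2)) (hy : y ∈ Icc (-(1 / 2) : ℝ) (1 / 2)) :
    g x - g y ≤ tInt h := by
  rw [← intervalIntegral.integral_eq_sub_of_hasDerivAt (fun z _ => hd z)
    (hc.intervalIntegrable y x)]
  have hsub : Set.uIoc y x ⊆ Set.Ioc (-(1 / 2)) (1 / 2) := by
    intro z hz
    rw [Set.uIoc, mem_Ioc] at hz
    exact ⟨(le_min hy.1 hx.1).trans_lt hz.1, hz.2.trans (max_le hy.2 hx.2)⟩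
  have hI : IntegrableOn (fun z => |g' z|) (Set.Ioc (-(1 / 2)) (1 / 2)) :=
    (hc.abs.intervalIntegrable (-(1 / 2)) (1 / 2)).1
  calc ∫ z in y..x, g' z ≤ ‖∫ z in y..x, g' z‖ := le_abs_self _
    _ ≤ ∫ z in Set.uIoc y x, ‖g' z‖ := intervalIntegral.norm_integral_le_integral_norm_uIoc
    _ ≤ ∫ z in Set.Ioc (-(1 / 2)) (1 / 2), |g' z| :=
        setIntegral_mono_set hI (ae_of_all _ fun z => abs_nonneg _) hsub.eventuallyLE
    _ = tInt fun z => |g' z| := by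
        rw [tInt, intervalIntegral.integral_of_le (by norm_num)]
    _ ≤ tInt h := tInt_mono hc.abs hh hle

lemma exists_le_tInt {f : ℝ → ℝ} (hf : Continuous f) :
    ∃ y ∈ Icc (-(1 / 2) : ℝ) (1 / 2), f y ≤ tInt f := by
  obtain ⟨y, hy, hmin⟩ := (isCompact_Icc (a := (-(1 / 2) : ℝ)) (b := 1 / 2)).exists_isMinOn
    ⟨0, by norm_num, by norm_num⟩ hf.continuousOn
  refine ⟨y, hy, ?_⟩
  calc f y = tInt fun _ => f y := (tInt_const _).symm
    _ ≤ tInt f := intervalIntegral.integral_mono_on (by norm_num) (by simp)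
        (hf.intervalIntegrable _ _) fun x hx => hmin hx

end Calculus

section Estimates

variable {μ R a b κ₁ κ₂ β γ T : ℝ}

lemma Sol.tInt_v_eq_one (S : Sol μ R a b κ₁ κ₂ β γ T) {t : ℝ} (ht : t ∈ Icc (0 : ℝ) T) :
    tInt (S.v t) = 1 := by
  rw [← S.mean_v]
  exact tInt_conserved S.smooth_v S.smooth_u S.periodic_u
    (fun s hs x => sub_eq_zero.1 (S.eq_mass s hs x)) ht

lemma Sol.contDiff_kappa (S : Sol μ R a b κ₁ κ₂ β γ T) :
    ContDiff ℝ (⊤ : ℕ∞)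
      fun p : ℝ × ℝ => kappa κ₁ κ₂ β (S.v p.1 p.2) (S.θ p.1 p.2) := by
  unfold kappa
  exact contDiff_const.add ((contDiff_const.mul S.smooth_v).mul
    (S.smooth_θ.rpow_const_of_ne fun p => (S.θ_pos _ _).ne'))

lemma Sol.tInt_energy (S : Sol μ R a b κ₁ κ₂ β γ T) {t : ℝ} (ht : t ∈ Icc (0 : ℝ) T) :
    tInt (fun x => R / (γ - 1) * S.θ t x + S.u t x ^ 2 / 2) =
      tInt (fun x => R / (γ - 1) * S.θ 0 x + S.u 0 x ^ 2 / 2) := by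
  have hv : ∀ p : ℝ × ℝ, S.v p.1 p.2 ≠ 0 := fun p => (S.v_pos _ _).ne'
  have hE : ContDiff ℝ (⊤ : ℕ∞)
      fun p : ℝ × ℝ => R / (γ - 1) * S.θ p.1 p.2 + S.u p.1 p.2 ^ 2 / 2 :=
    (contDiff_const.mul S.smooth_θ).add ((S.smooth_u.pow 2).div_const 2)
  have hA : ContDiff ℝ (⊤ : ℕ∞)
      fun p : ℝ × ℝ => μ * S.u p.1 p.2 * px S.u p.1 p.2 / S.v p.1 p.2 :=
    ((contDiff_const.mul S.smooth_u).mul (contDiff_px S.smooth_u)).div S.smooth_v hv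
  have hB : ContDiff ℝ (⊤ : ℕ∞)
      fun p : ℝ × ℝ => kappa κ₁ κ₂ β (S.v p.1 p.2) (S.θ p.1 p.2) * px S.θ p.1 p.2
        / S.v p.1 p.2 :=
    (S.contDiff_kappa.mul (contDiff_px S.smooth_θ)).div S.smooth_v hv
  have hP : ContDiff ℝ (⊤ : ℕ∞)
      fun p : ℝ × ℝ => R * S.θ p.1 p.2 / S.v p.1 p.2 * S.u p.1 p.2 :=
    ((contDiff_const.mul S.smooth_θ).div S.smooth_v hv).mul S.smooth_u
  refine tInt_conserved (f := fun s y => R / (γ - 1) * S.θ s y + S.u s y ^ 2 / 2)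
    (g := fun s y => μ * S.u s y * px S.u s y / S.v s y
      + kappa κ₁ κ₂ β (S.v s y) (S.θ s y) * px S.θ s y / S.v s y
      - R * S.θ s y / S.v s y * S.u s y - S.q s y) hE
    (((hA.add hB).sub hP).sub S.smooth_q) (fun s x => ?_) (fun s hs x => ?_) ht
  · simp only [S.periodic_u s x, S.periodic_v s x, S.periodic_θ s x, S.periodic_q s x,
      periodic_px S.periodic_u s x, periodic_px S.periodic_θ s x]
  · have h := S.eq_energy s hs x
    have hd := (((hasDerivAt_px (f := fun s y => μ * S.u s y * px S.u s y / S.v s y)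
      hA s x).add (hasDerivAt_px (f := fun s y =>
        kappa κ₁ κ₂ β (S.v s y) (S.θ s y) * px S.θ s y / S.v s y) hB s x)).sub
      (hasDerivAt_px (f := fun s y => R * S.θ s y / S.v s y * S.u s y) hP s x)).sub (hasDerivAt_px S.smooth_q s x)
    have hd' := hd.deriv
    refine Eq.trans ?_ hd'.symm
    linarith

/-- The temperature has a mean bounded in terms of the size of the initial data. -/
lemma Sol.tInt_θ_le (S : Sol μ R a b κ₁ κ₂ β γ T) (hR : 0 < R) (hγ : 1 < γ) {M ε t : ℝ}
    (hM : 1 ≤ M) (hS : S.Bounded M ε) (ht : t ∈ Icc (0 : ℝ) T) :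
    tInt (S.θ t) ≤ (R / (γ - 1) + 1) * M ^ 2 / (R / (γ - 1)) := by
  have hc : 0 < R / (γ - 1) := div_pos hR (by linarith)
  set c := R / (γ - 1) with hcdef
  have hθ := fun t => (contDiff_slice S.smooth_θ t).continuous
  have hu := fun t => (contDiff_slice S.smooth_u t).continuous
  have hH : H2sq (S.v 0) + H2sq (S.u 0) + H2sq (S.θ 0) ≤ M ^ 2 :=
    (Real.sqrt_le_left (by linarith)).1 hS.1
  have hnn : ∀ f : ℝ → ℝ, 0 ≤ L2sq f := fun f => tInt_nonneg fun x => sq_nonneg _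
  have hsum : L2sq (S.u 0) + L2sq (S.θ 0) ≤ M ^ 2 := by
    unfold H2sq at hH
    linarith [hnn (S.v 0), hnn (deriv (S.v 0)), hnn (deriv (deriv (S.v 0))),
      hnn (deriv (S.u 0)), hnn (deriv (deriv (S.u 0))), hnn (deriv (S.θ 0)),
      hnn (deriv (deriv (S.θ 0)))]
  have h0 : tInt (fun x => c * S.θ 0 x + S.u 0 x ^ 2 / 2) ≤ (c + 1) * M ^ 2 := by
    calc tInt (fun x => c * S.θ 0 x + S.u 0 x ^ 2 / 2)
        ≤ tInt (fun x => (c / 2 + c / 2 * S.θ 0 x ^ 2) + 1 / 2 * S.u 0 x ^ 2) :=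
          tInt_mono (by have := hθ 0; have := hu 0; fun_prop)
            (by have := hθ 0; have := hu 0; fun_prop) fun x => by
              nlinarith [mul_nonneg hc.le (sq_nonneg (S.θ 0 x - 1))]
      _ = c / 2 + c / 2 * L2sq (S.θ 0) + 1 / 2 * L2sq (S.u 0) := by
          have h1 := hθ 0
          have h2 := hu 0
          rw [tInt_add (by fun_prop) (by fun_prop), tInt_add (by fun_prop) (by fun_prop),
            tInt_const, tInt_const_mul, tInt_const_mul, L2sq, L2sq]
      _ ≤ (c + 1) * M ^ 2 := by
          nlinarith [hnn (S.u 0), hnn (S.θ 0), mul_le_mul_of_nonneg_left hsum hc.le,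
            mul_nonneg hc.le (hnn (S.u 0)), mul_le_mul_of_nonneg_left hM hc.le,
            mul_nonneg hc.le (mul_nonneg (by linarith : (0 : ℝ) ≤ M - 1)
              (by linarith : (0 : ℝ) ≤ M + 1))]
  rw [le_div_iff₀ hc]
  calc tInt (S.θ t) * c = tInt (fun x => c * S.θ t x) := by rw [tInt_const_mul, mul_comm]
    _ ≤ tInt (fun x => c * S.θ t x + S.u t x ^ 2 / 2) :=
        tInt_mono (by have := hθ t; fun_prop) (by have := hθ t; have := hu t; fun_prop)
          fun x => by nlinarith [sq_nonneg (S.u t x)]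
    _ = _ := S.tInt_energy ht
    _ ≤ _ := h0

lemma Sol.tInt_le_Y (S : Sol μ R a b κ₁ κ₂ β γ T) {t : ℝ} (ht : 0 ≤ t) :
    tInt (fun x => kappa κ₁ κ₂ β (S.v t x) (S.θ t x) ^ 2 * px S.θ t x ^ 2 / S.v t x ^ 2)
      ≤ S.Y t := by
  have hc : Continuous fun p : ℝ × ℝ => kappa κ₁ κ₂ β (S.v p.1 p.2) (S.θ p.1 p.2) ^ 2
      * px S.θ p.1 p.2 ^ 2 / S.v p.1 p.2 ^ 2 :=
    ((S.contDiff_kappa.continuous.pow 2).mul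
      ((contDiff_px S.smooth_θ).continuous.pow 2)).div (S.smooth_v.continuous.pow 2)
      fun p => (pow_pos (S.v_pos _ _) 2).ne'
  refine le_csSup (isCompact_Icc.image (continuous_tInt (f := fun s x =>
    kappa κ₁ κ₂ β (S.v s x) (S.θ s x) ^ 2 * px S.θ s x ^ 2 / S.v s x ^ 2) hc)).bddAbove ?_
  exact ⟨t, ⟨ht, le_rfl⟩, rfl⟩

lemma Sol.tInt_rpow_mul_sq_le (S : Sol μ R a b κ₁ κ₂ β γ T) (hκ₁ : 0 < κ₁) (hκ₂ : 0 < κ₂)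
    {t : ℝ} (ht : 0 ≤ t) :
    κ₂ ^ 2 * tInt (fun x => (S.θ t x ^ β * px S.θ t x) ^ 2) ≤ S.Y t := by
  refine le_trans ?_ (S.tInt_le_Y ht)
  have hθ := (contDiff_slice S.smooth_θ t).continuous
  have hv := (contDiff_slice S.smooth_v t).continuous
  have hθx := (contDiff_slice (contDiff_px S.smooth_θ) t).continuous
  have hk := (contDiff_slice (f := fun s x => kappa κ₁ κ₂ β (S.v s x) (S.θ s x))
    S.contDiff_kappa t).continuous
  have hp : Continuous fun x => S.θ t x ^ β :=
    hθ.rpow_const fun x => Or.inl (S.θ_pos t x).ne'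
  rw [← tInt_const_mul]
  refine tInt_mono (by fun_prop) (((hk.pow 2).mul (hθx.pow 2)).div (hv.pow 2)
    fun x => (pow_pos (S.v_pos _ _) 2).ne') fun x => ?_
  have hvx := S.v_pos t x
  have hr := Real.rpow_nonneg (S.θ_pos t x).le β
  rw [le_div_iff₀ (pow_pos hvx 2)]
  have h1 : κ₂ * S.v t x * S.θ t x ^ β ≤ kappa κ₁ κ₂ β (S.v t x) (S.θ t x) := by
    unfold kappa; linarith
  have h2 : (κ₂ * S.v t x * S.θ t x ^ β) ^ 2 ≤ kappa κ₁ κ₂ β (S.v t x) (S.θ t x) ^ 2 :=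
    pow_le_pow_left₀ (by positivity) h1 2
  calc κ₂ ^ 2 * (S.θ t x ^ β * px S.θ t x) ^ 2 * S.v t x ^ 2
      = (κ₂ * S.v t x * S.θ t x ^ β) ^ 2 * px S.θ t x ^ 2 := by ring
    _ ≤ _ := mul_le_mul_of_nonneg_right h2 (sq_nonneg _)

/-- Pointwise bound of a power of the temperature by its mean and `𝔜`. -/
lemma Sol.rpow_θ_le (S : Sol μ R a b κ₁ κ₂ β γ T) (hκ₁ : 0 < κ₁) (hκ₂ : 0 < κ₂) (hβ : 0 < β)
    {K t : ℝ} (ht : 0 ≤ t) (hK : tInt (S.θ t) ≤ K) {x : ℝ}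
    (hx : x ∈ Icc (-(1 / 2) : ℝ) (1 / 2)) :
    S.θ t x ^ (β + 3 / 2) ≤
      (K ^ (β + 3 / 2) + (β + 3 / 2) / 2 * (K + 1 / κ₂ ^ 2)) * (1 + √(S.Y t)) := by
  have hθ := (contDiff_slice S.smooth_θ t).continuous
  have hθx := (contDiff_slice (contDiff_px S.smooth_θ) t).continuous
  have hp : ∀ r : ℝ, Continuous fun x => S.θ t x ^ r := fun r =>
    hθ.rpow_const fun x => Or.inl (S.θ_pos t x).ne'
  have hY0 : 0 ≤ S.Y t := by
    refine le_trans ?_ (S.tInt_rpow_mul_sq_le hκ₁ hκ₂ ht)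
    exact mul_nonneg (sq_nonneg _) (tInt_nonneg fun x => sq_nonneg _)
  have hI := S.tInt_rpow_mul_sq_le hκ₁ hκ₂ ht
  set I := tInt (fun x => (S.θ t x ^ β * px S.θ t x) ^ 2) with hIdef
  set l := 1 + √(S.Y t) with hl
  have hl1 : 1 ≤ l := by have := Real.sqrt_nonneg (S.Y t); linarith
  have hl0 : 0 < l := by linarith
  have hYl : S.Y t ≤ l ^ 2 := by
    nlinarith [Real.sq_sqrt hY0, Real.sqrt_nonneg (S.Y t)]
  obtain ⟨y, hy, hyK⟩ := exists_le_tInt hθ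
  have hK0 : 0 ≤ K := ((S.θ_pos t y).le.trans hyK).trans hK
  have hd : ∀ z, HasDerivAt (fun z => S.θ t z ^ (β + 3 / 2))
      (px S.θ t z * (β + 3 / 2) * S.θ t z ^ (β + 3 / 2 - 1)) z := fun z =>
    (hasDerivAt_px S.smooth_θ t z).rpow_const (Or.inl (S.θ_pos t z).ne')
  have hosc := sub_le_tInt_of_abs_deriv_le
    (h := fun z => (β + 3 / 2) / 2 * l * S.θ t z
      + (β + 3 / 2) / 2 / l * (S.θ t z ^ β * px S.θ t z) ^ 2) hd
    (by have := hp (β + 3 / 2 - 1); fun_prop) (by have := hp β; fun_prop)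
    (fun z => by
      have hz := S.θ_pos t z
      have hsplit : S.θ t z ^ (β + 3 / 2 - 1) = S.θ t z ^ β * √(S.θ t z) := by
        rw [Real.sqrt_eq_rpow, ← Real.rpow_add hz]; congr 1; ring
      have hw := Real.rpow_pos_of_pos hz β
      rw [hsplit, show px S.θ t z * (β + 3 / 2) * (S.θ t z ^ β * √(S.θ t z))
        = (β + 3 / 2) * ((S.θ t z ^ β * px S.θ t z) * √(S.θ t z)) by ring, abs_mul,
        abs_of_pos (by linarith : 0 < β + 3 / 2), abs_mul,
        abs_of_nonneg (Real.sqrt_nonneg (S.θ t z))]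
      have hW := sq_abs (S.θ t z ^ β * px S.θ t z)
      set W := |S.θ t z ^ β * px S.θ t z|
      rw [← hW]
      have hsq := Real.sq_sqrt hz.le
      set r := √(S.θ t z)
      rw [← hsq]
      have key : W * r ≤ (l * r ^ 2 + W ^ 2 / l) / 2 := by
        have : (l * r ^ 2 + W ^ 2 / l) / 2 - W * r = (l * r - W) ^ 2 / (2 * l) := by
          field_simp; ring
        have h2 : 0 ≤ (l * r - W) ^ 2 / (2 * l) := by positivity
        linarith
      calc (β + 3 / 2) * (W * r) ≤ (β + 3 / 2) * ((l * r ^ 2 + W ^ 2 / l) / 2) :=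
            mul_le_mul_of_nonneg_left key (by linarith)
        _ = _ := by ring) hx hy
  rw [tInt_add (by fun_prop) (by have := hp β; fun_prop), tInt_const_mul, tInt_const_mul,
    ← hIdef] at hosc
  have h1 : S.θ t y ^ (β + 3 / 2) ≤ K ^ (β + 3 / 2) :=
    Real.rpow_le_rpow (S.θ_pos t y).le (hyK.trans hK) (by linarith)
  have h2 : K ^ (β + 3 / 2) ≤ K ^ (β + 3 / 2) * l :=
    le_mul_of_one_le_right (Real.rpow_nonneg hK0 _) hl1
  have h3 : (β + 3 / 2) / 2 * l * tInt (S.θ t) ≤ (β + 3 / 2) / 2 * l * K :=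
    mul_le_mul_of_nonneg_left hK (by positivity)
  have h4 : (β + 3 / 2) / 2 / l * I ≤ (β + 3 / 2) / 2 / l * (l ^ 2 / κ₂ ^ 2) := by
    refine mul_le_mul_of_nonneg_left ?_ (by positivity)
    rw [le_div_iff₀ (by positivity)]
    linarith
  have h5 : (β + 3 / 2) / 2 / l * (l ^ 2 / κ₂ ^ 2) = (β + 3 / 2) / 2 * (1 / κ₂ ^ 2) * l := by
    field_simp
  have h6 : (K ^ (β + 3 / 2) + (β + 3 / 2) / 2 * (K + 1 / κ₂ ^ 2)) * l
      = K ^ (β + 3 / 2) * l + (β + 3 / 2) / 2 * l * K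
        + (β + 3 / 2) / 2 * (1 / κ₂ ^ 2) * l := by ring
  rw [h6]
  linarith

lemma one_add_sqrt_rpow_le {y r : ℝ} (hy : 0 ≤ y) (hr : 0 ≤ r) :
    (1 + √y) ^ r ≤ 2 ^ r * (1 + y ^ (r / 2)) := by
  have hs := Real.sqrt_nonneg y
  have e : √y ^ r = y ^ (r / 2) := by
    rw [Real.sqrt_eq_rpow, ← Real.rpow_mul hy]; congr 1; ring
  have hy' : 0 ≤ y ^ (r / 2) := Real.rpow_nonneg hy _
  have h2 : (0 : ℝ) ≤ 2 ^ r := Real.rpow_nonneg (by norm_num) r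
  rcases le_total (√y) 1 with h | h
  · calc (1 + √y) ^ r ≤ 2 ^ r := Real.rpow_le_rpow (by linarith) (by linarith) hr
      _ ≤ _ := le_mul_of_one_le_right h2 (by linarith)
  · calc (1 + √y) ^ r ≤ (2 * √y) ^ r := Real.rpow_le_rpow (by linarith) (by linarith) hr
      _ = 2 ^ r * y ^ (r / 2) := by rw [Real.mul_rpow (by norm_num) hs, e]
      _ ≤ _ := mul_le_mul_of_nonneg_left (by linarith) h2

/-- The basic estimate obtained by testing the radiation equation with `q`. -/
lemma Sol.tInt_radiation_le (S : Sol μ R a b κ₁ κ₂ β γ T) {t : ℝ} (ht : t ∈ Icc (0 : ℝ) T) :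
    1 / 2 * tInt (fun x => px S.q t x ^ 2 / S.v t x)
        + a * tInt (fun x => S.v t x * S.q t x ^ 2)
      ≤ b ^ 2 / 2 * tInt (fun x => S.v t x * S.θ t x ^ 8) := by
  have hvne : ∀ p : ℝ × ℝ, S.v p.1 p.2 ≠ 0 := fun p => (S.v_pos _ _).ne'
  have hF : ContDiff ℝ (⊤ : ℕ∞) fun p : ℝ × ℝ => px S.q p.1 p.2 / S.v p.1 p.2 :=
    (contDiff_px S.smooth_q).div S.smooth_v hvne
  have hθ4 : ContDiff ℝ (⊤ : ℕ∞) fun p : ℝ × ℝ => S.θ p.1 p.2 ^ 4 := S.smooth_θ.pow 4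
  have cv := (contDiff_slice S.smooth_v t).continuous
  have cq := (contDiff_slice S.smooth_q t).continuous
  have cqx := (contDiff_slice (contDiff_px S.smooth_q) t).continuous
  have cθ := (contDiff_slice S.smooth_θ t).continuous
  have cD : Continuous fun x => px S.q t x ^ 2 / S.v t x :=
    (cqx.pow 2).div cv fun x => (S.v_pos t x).ne'
  have hd : ∀ x, HasDerivAt
      (fun x => (px S.q t x / S.v t x - b * S.θ t x ^ 4) * S.q t x)
      (px S.q t x ^ 2 / S.v t x + a * (S.v t x * S.q t x ^ 2)
        - b * (S.θ t x ^ 4 * px S.q t x)) x := fun x => by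
    have h := ((hasDerivAt_px (f := fun s y => px S.q s y / S.v s y) hF t x).sub
      ((hasDerivAt_px (f := fun s y => S.θ s y ^ 4) hθ4 t x).const_mul b)).mul
      (hasDerivAt_px S.smooth_q t x)
    refine h.congr_deriv ?_
    have e := S.eq_rad t ht x
    have e' : px (fun s y => px S.q s y / S.v s y) t x
        - b * px (fun s y => S.θ s y ^ 4) t x = a * S.v t x * S.q t x := by linarith
    simp only [Pi.sub_apply]
    rw [e']
    ring
  have h0 := tInt_eq_zero_of_periodic (fun x => by
    simp only [S.periodic_v t x, S.periodic_θ t x, S.periodic_q t x,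
      periodic_px S.periodic_q t x]) hd (by fun_prop)
  rw [← tInt_const_mul, ← tInt_const_mul, ← tInt_const_mul, ← tInt_add (by fun_prop)
    (by fun_prop)]
  have hle := tInt_mono (f := fun x => 1 / 2 * (px S.q t x ^ 2 / S.v t x)
      + a * (S.v t x * S.q t x ^ 2))
    (g := fun x => b ^ 2 / 2 * (S.v t x * S.θ t x ^ 8)
      + (px S.q t x ^ 2 / S.v t x + a * (S.v t x * S.q t x ^ 2)
        - b * (S.θ t x ^ 4 * px S.q t x))) (by fun_prop) (by fun_prop) fun x => by
    have hv := S.v_pos t x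
    have e : 1 / 2 * (px S.q t x ^ 2 / S.v t x) + b ^ 2 / 2 * (S.v t x * S.θ t x ^ 8)
        - b * (S.θ t x ^ 4 * px S.q t x)
        = (px S.q t x - b * S.v t x * S.θ t x ^ 4) ^ 2 / (2 * S.v t x) := by
      field_simp; ring
    have h2 : 0 ≤ (px S.q t x - b * S.v t x * S.θ t x ^ 4) ^ 2 / (2 * S.v t x) := by
      positivity
    linarith
  refine hle.trans_eq ?_
  rw [tInt_add (by fun_prop) (by fun_prop), h0, add_zero]

end Estimates

end RadHydro

theorem stmt_8 (μ R a b κ₁ κ₂ β γ : ℝ)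
    (hμ : 0 < μ) (hR : 0 < R) (ha : 0 < a) (hb : 0 < b)
    (hκ₁ : 0 < κ₁) (hκ₂ : 0 < κ₂) (hβ : 0 < β) (hγ : 1 < γ)
    (T M ε : ℝ) (hT : 0 < T) (hM : 1 ≤ M) (hε0 : 0 < ε) (hε1 : ε ≤ 1) :
    ∃ C : ℝ, 0 < C ∧
      ∀ S : Sol μ R a b κ₁ κ₂ β γ T, S.Bounded M ε →
        ∀ t ∈ Icc (0 : ℝ) T,
          tInt (fun x => (px S.q t x) ^ 2 / S.v t x) + tInt (fun x => S.v t x * (S.q t x) ^ 2)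
            ≤ C * (1 + S.Y t ^ (8 / (2 * β + 3))) := by
  set K := (R / (γ - 1) + 1) * M ^ 2 / (R / (γ - 1)) with hKdef
  have hc : 0 < R / (γ - 1) := div_pos hR (by linarith)
  have hK0 : 0 < K := by positivity
  set A := K ^ (β + 3 / 2) + (β + 3 / 2) / 2 * (K + 1 / κ₂ ^ 2) with hA
  have hA0 : 0 < A := by positivity
  set r := 16 / (2 * β + 3) with hr
  have hr0 : 0 < r := by positivity
  set B := A ^ r * 2 ^ r with hB
  have hB0 : 0 < B := by positivity
  refine ⟨(2 + 1 / a) * (b ^ 2 / 2 * B), by positivity, fun S hS t ht => ?_⟩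
  have hY0 : 0 ≤ S.Y t :=
    (mul_nonneg (sq_nonneg κ₂) (tInt_nonneg fun x => sq_nonneg _)).trans
      (S.tInt_rpow_mul_sq_le hκ₁ hκ₂ ht.1)
  have hKt := S.tInt_θ_le hR hγ hM hS ht
  have hθ8 : ∀ x ∈ Icc (-(1 / 2) : ℝ) (1 / 2),
      S.θ t x ^ 8 ≤ B * (1 + S.Y t ^ (8 / (2 * β + 3))) := fun x hx => by
    have h := S.rpow_θ_le hκ₁ hκ₂ hβ ht.1 hKt hx
    have hs := Real.sqrt_nonneg (S.Y t)
    calc S.θ t x ^ 8 = (S.θ t x ^ (β + 3 / 2)) ^ r := by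
          rw [← Real.rpow_mul (S.θ_pos t x).le, ← Real.rpow_natCast]
          congr 1
          rw [hr]; push_cast; field_simp; norm_num
      _ ≤ (A * (1 + √(S.Y t))) ^ r :=
          Real.rpow_le_rpow (Real.rpow_nonneg (S.θ_pos t x).le _) h hr0.le
      _ = A ^ r * (1 + √(S.Y t)) ^ r := Real.mul_rpow hA0.le (by linarith)
      _ ≤ A ^ r * (2 ^ r * (1 + S.Y t ^ (r / 2))) :=
          mul_le_mul_of_nonneg_left (one_add_sqrt_rpow_le hY0 hr0.le) (by positivity)
      _ = B * (1 + S.Y t ^ (8 / (2 * β + 3))) := by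
          rw [hB, hr, show 16 / (2 * β + 3) / 2 = 8 / (2 * β + 3) by ring]; ring
  set N := B * (1 + S.Y t ^ (8 / (2 * β + 3))) with hN
  have cv := (contDiff_slice S.smooth_v t).continuous
  have cθ := (contDiff_slice S.smooth_θ t).continuous
  have hint : tInt (fun x => S.v t x * S.θ t x ^ 8) ≤ N := by
    calc tInt (fun x => S.v t x * S.θ t x ^ 8) ≤ tInt (fun x => N * S.v t x) :=
          intervalIntegral.integral_mono_on (by norm_num)
            ((by fun_prop : Continuous fun x => S.v t x * S.θ t x ^ 8).intervalIntegrable _ _)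
            ((by fun_prop : Continuous fun x => N * S.v t x).intervalIntegrable _ _)
            fun x hx => by
              rw [mul_comm]
              exact mul_le_mul_of_nonneg_right (hθ8 x hx) (S.v_pos t x).le
      _ = N := by rw [tInt_const_mul, S.tInt_v_eq_one ht, mul_one]
  have hrad := S.tInt_radiation_le ht
  have hP : 0 ≤ tInt (fun x => px S.q t x ^ 2 / S.v t x) :=
    tInt_nonneg fun x => div_nonneg (sq_nonneg _) (S.v_pos t x).le
  have hQ : 0 ≤ tInt (fun x => S.v t x * S.q t x ^ 2) :=
    tInt_nonneg fun x => mul_nonneg (S.v_pos t x).le (sq_nonneg _)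
  set P := tInt (fun x => px S.q t x ^ 2 / S.v t x)
  set Q := tInt (fun x => S.v t x * S.q t x ^ 2)
  have hD : 1 / 2 * P + a * Q ≤ b ^ 2 / 2 * N :=
    hrad.trans (mul_le_mul_of_nonneg_left hint (by positivity))
  have hPle : P ≤ 2 * (b ^ 2 / 2 * N) := by nlinarith [mul_nonneg ha.le hQ]
  have hQle : Q ≤ 1 / a * (b ^ 2 / 2 * N) := by
    rw [one_div_mul_eq_div, le_div_iff₀ ha]
    linarith
  calc P + Q ≤ (2 + 1 / a) * (b ^ 2 / 2 * N) := by linarith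
    _ = _ := by rw [hN]; ring
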